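/- Let 𝒳 be a complete separable metric space and let F be a countable family of Borel measurable functions f : 𝒳 → [0,1]. If there exist γ > 0 and k ∈ ℕ such that no finite subset of 𝒳 of cardinality k is γ-shattered by F (i.e., dim_γ(F) < ∞), then for every stationary ergodic process X₁, X₂, … with values in 𝒳, almost surely limsup_{m→∞} Γ_m(F) ≤ 10γ. -/

import Mathlib

open MeasureTheory Filter

/-- The `m`-sample discrepancy of the family `F` at the sample point `ω`, for the
process `Xᵢ = ξ ∘ Tⁱ`. -/
noncomputable def discrepancy {Ω X : Type*} [MeasurableSpace Ω] (μ : Measure Ω)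
    (T : Ω → Ω) (ξ : Ω → X) (F : Set (X → ℝ)) (m : ℕ) (ω : Ω) : ℝ :=
  ⨆ f : F, |(1 / (m : ℝ)) * ∑ i ∈ Finset.Icc 1 m, (f : X → ℝ) (ξ (T^[i] ω)) -
      ∫ x, (f : X → ℝ) (ξ x) ∂μ|

/-- `F` γ-shatters the finite set `D`. -/
def GammaShatters {X : Type*} (F : Set (X → ℝ)) (γ : ℝ) (D : Finset X) : Prop :=
  ∃ α : ℝ, ∀ D₀ ⊆ D, ∃ f ∈ F,
    (∀ x ∈ D₀, f x > α + γ) ∧ (∀ x ∈ D, x ∉ D₀ → f x < α - γ)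

section Birkhoff

open scoped Topology

variable {Ω : Type*}

/-- The running maximum of the Birkhoff sums `S₀ = 0, S₁, …, Sₙ`, defined by its recursion. -/
def birkhoffMax (T : Ω → Ω) (g : Ω → ℝ) : ℕ → Ω → ℝ
  | 0, _ => 0
  | n + 1, ω => max 0 (g ω + birkhoffMax T g n (T ω))

lemma birkhoffMax_nonneg (T : Ω → Ω) (g : Ω → ℝ) (n : ℕ) (ω : Ω) : 0 ≤ birkhoffMax T g n ω := by
  cases n with
  | zero => exact le_rfl
  | succ n => exact le_max_left _ _

lemma birkhoffMax_le_succ (T : Ω → Ω) (g : Ω → ℝ) (n : ℕ) (ω : Ω) :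
    birkhoffMax T g n ω ≤ birkhoffMax T g (n + 1) ω := by
  induction n generalizing ω with
  | zero => exact birkhoffMax_nonneg T g 1 ω
  | succ n ih =>
    change max 0 _ ≤ max 0 _
    gcongr
    exact ih (T ω)

lemma birkhoffSum_le_birkhoffMax (T : Ω → Ω) (g : Ω → ℝ) (n : ℕ) (ω : Ω) :
    birkhoffSum T g n ω ≤ birkhoffMax T g n ω := by
  induction n generalizing ω with
  | zero => simp [birkhoffMax]
  | succ n ih =>
    rw [birkhoffSum_succ']
    exact le_trans (by gcongr; exact ih (T ω)) (le_max_right _ _)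

variable [MeasurableSpace Ω] {μ : Measure Ω}

lemma measurable_birkhoffMax {T : Ω → Ω} {g : Ω → ℝ} (hT : Measurable T) (hg : Measurable g)
    (n : ℕ) : Measurable (birkhoffMax T g n) := by
  induction n with
  | zero => exact measurable_const
  | succ n ih => exact measurable_const.max (hg.add (ih.comp hT))

lemma measurable_birkhoffSum {T : Ω → Ω} {g : Ω → ℝ} (hT : Measurable T) (hg : Measurable g)
    (n : ℕ) : Measurable (birkhoffSum T g n) := by
  unfold birkhoffSum
  exact Finset.measurable_sum _ fun i _ => hg.comp (hT.iterate i)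

lemma integrable_birkhoffMax {T : Ω → Ω} {g : Ω → ℝ} (hT : MeasurePreserving T μ μ)
    (hg : Integrable g μ) (n : ℕ) : Integrable (birkhoffMax T g n) μ := by
  induction n with
  | zero => exact integrable_zero _ _ _
  | succ n ih => exact (integrable_zero _ _ _).sup (hg.add (hT.integrable_comp_of_integrable ih))

/-- An integrable function with negative integral has Birkhoff sums bounded above along almost
every orbit of an ergodic map. -/
lemma Ergodic.ae_bddAbove_birkhoffSum {T : Ω → Ω} (hT : Ergodic T μ) {g : Ω → ℝ}
    (hgm : Measurable g) (hg : Integrable g μ) (hneg : ∫ ω, g ω ∂μ < 0) :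
    ∀ᵐ ω ∂μ, BddAbove (Set.range fun n => birkhoffSum T g n ω) := by
  set B : Set Ω := {ω | BddAbove (Set.range fun n => birkhoffSum T g n ω)}
  have hB : MeasurableSet B :=
    measurableSet_bddAbove_range fun n => measurable_birkhoffSum hT.measurable hgm n
  have hinv : T ⁻¹' B = B := by
    ext ω
    constructor
    · rintro ⟨c, hc⟩
      refine ⟨max 0 (g ω + c), ?_⟩
      rintro _ ⟨n, rfl⟩
      cases n with
      | zero => simp
      | succ n =>
        simp only [birkhoffSum_succ']
        exact le_max_of_le_right (by gcongr; exact hc ⟨n, rfl⟩)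
    · rintro ⟨c, hc⟩
      refine ⟨c - g ω, ?_⟩
      rintro _ ⟨n, rfl⟩
      have := hc ⟨n + 1, rfl⟩
      simp only [birkhoffSum_succ'] at this
      simp only
      linarith
  rcases hT.toPreErgodic.ae_mem_or_ae_notMem hB hinv with h | h
  · exact h
  exfalso
  have htop : ∀ ω, ω ∉ B → Tendsto (fun n => birkhoffMax T g n ω) atTop atTop := by
    intro ω hω
    refine tendsto_atTop_atTop_of_monotone
      (monotone_nat_of_le_succ fun n => birkhoffMax_le_succ T g n ω) fun b => ?_
    by_contra! hb
    exact hω ⟨b, by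
      rintro _ ⟨n, rfl⟩
      exact (birkhoffSum_le_birkhoffMax T g n ω).trans (hb n).le⟩
  have hstep : ∀ n, 0 ≤ ∫ ω, max (-birkhoffMax T g n (T ω)) (g ω) ∂μ := by
    intro n
    have h1 := integrable_birkhoffMax hT.toMeasurePreserving hg (n + 1)
    have h0 := integrable_birkhoffMax hT.toMeasurePreserving hg n
    have h2 := hT.toMeasurePreserving.integrable_comp_of_integrable h0
    have hcomp : ∫ ω, birkhoffMax T g n (T ω) ∂μ = ∫ ω, birkhoffMax T g n ω ∂μ := by
      have := integral_map (μ := μ) hT.measurable.aemeasurable (f := birkhoffMax T g n)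
        (measurable_birkhoffMax hT.measurable hgm n).aestronglyMeasurable
      rw [← this, hT.toMeasurePreserving.map_eq]
    have heq : ∀ ω, max (-birkhoffMax T g n (T ω)) (g ω)
        = birkhoffMax T g (n + 1) ω - birkhoffMax T g n (T ω) := by
      intro ω
      rw [birkhoffMax, ← max_sub_sub_right, zero_sub, add_sub_cancel_right]
    simp_rw [heq]
    rw [integral_sub h1 (by exact h2), hcomp, sub_nonneg]
    exact integral_mono h0 h1 fun ω => birkhoffMax_le_succ T g n ω
  have hlim : Tendsto (fun n => ∫ ω, max (-birkhoffMax T g n (T ω)) (g ω) ∂μ) atTop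
      (𝓝 (∫ ω, g ω ∂μ)) := by
    refine tendsto_integral_of_dominated_convergence (fun ω => |g ω|) (fun n => ?_) hg.abs
      (fun n => ?_) ?_
    · exact (((measurable_birkhoffMax hT.measurable hgm n).comp hT.measurable).neg.max
        hgm).aestronglyMeasurable
    · refine Eventually.of_forall fun ω => ?_
      rw [Real.norm_eq_abs, abs_le]
      exact ⟨(neg_abs_le _).trans (le_max_right _ _), max_le
        ((neg_nonpos.2 (birkhoffMax_nonneg T g n _)).trans (abs_nonneg _)) (le_abs_self _)⟩
    · filter_upwards [h] with ω hω
      have hω' : T ω ∉ B := fun h' => hω (hinv ▸ h')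
      refine tendsto_const_nhds.congr' ?_
      filter_upwards [(htop _ hω').eventually_ge_atTop (-g ω)] with n hn
      exact (max_eq_right (by linarith)).symm
  exact absurd (ge_of_tendsto' hlim hstep) (not_le.2 hneg)

/-- The upper half of the pointwise ergodic theorem, along the orbit started at time one. -/
lemma Ergodic.ae_eventually_average_le [IsProbabilityMeasure μ] {T : Ω → Ω} (hT : Ergodic T μ)
    {g : Ω → ℝ} (hgm : Measurable g) (hg : Integrable g μ) {ε : ℝ} (hε : 0 < ε) :
    ∀ᵐ ω ∂μ, ∀ᶠ m : ℕ in atTop,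
      (1 / (m : ℝ)) * ∑ i ∈ Finset.Icc 1 m, g (T^[i] ω) ≤ ∫ ω, g ω ∂μ + ε := by
  set c := ∫ ω, g ω ∂μ + ε / 2 with hc
  have hint : ∫ ω, (g ω - c) ∂μ < 0 := by
    rw [integral_sub hg (integrable_const _)]
    simp [hc, hε]
  have h := hT.quasiMeasurePreserving.ae
    (hT.ae_bddAbove_birkhoffSum (hgm.sub_const c) (hg.sub (integrable_const c)) hint)
  filter_upwards [h] with ω ⟨b, hb⟩
  have hlim := tendsto_natCast_atTop_atTop (R := ℝ)
  filter_upwards [hlim.eventually_ge_atTop (b / (ε / 2)), eventually_gt_atTop 0] with m hm hm0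
  have hm0' : (0 : ℝ) < m := by exact_mod_cast hm0
  have hsum : birkhoffSum T (fun ω => g ω - c) m (T ω)
      = ∑ i ∈ Finset.Icc 1 m, g (T^[i] ω) - m * c := by
    rw [birkhoffSum, Finset.sum_sub_distrib, ← Finset.Ico_add_one_right_eq_Icc,
      Finset.sum_Ico_eq_sum_range]
    simp only [← Function.iterate_succ_apply, add_comm 1, Nat.add_sub_cancel, Finset.sum_const,
      Finset.card_range, nsmul_eq_mul, Nat.succ_eq_add_one]
  have hle := hb ⟨m, rfl⟩
  simp only [hsum] at hle
  rw [div_le_iff₀ (by positivity)] at hm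
  rw [one_div, inv_mul_le_iff₀ hm0']
  have : m * (∫ ω, g ω ∂μ + ε) = m * c + m * (ε / 2) := by rw [hc]; ring
  linarith

end Birkhoff

section Bracketing

open scoped Topology

variable {Ω ι : Type*}

/-- The points at which members of the subfamily indexed by `A` lie both above `α + γ` and below
`α - γ`. -/
def gapSet (g : ι → Ω → ℝ) (α γ : ℝ) (A : Set ι) : Set Ω :=
  (⋃ i ∈ A, {ω | α + γ < g i ω}) ∩ ⋃ i ∈ A, {ω | g i ω < α - γ}

lemma gapSet_mono (g : ι → Ω → ℝ) (α γ : ℝ) {A B : Set ι} (h : A ⊆ B) :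
    gapSet g α γ A ⊆ gapSet g α γ B :=
  Set.inter_subset_inter (Set.biUnion_subset_biUnion_left h) (Set.biUnion_subset_biUnion_left h)

lemma measurableSet_gapSet [MeasurableSpace Ω] [Countable ι] {g : ι → Ω → ℝ}
    (hg : ∀ i, Measurable (g i)) (α γ : ℝ) (A : Set ι) : MeasurableSet (gapSet g α γ A) :=
  (MeasurableSet.biUnion A.to_countable fun i _ => measurableSet_lt measurable_const (hg i)).inter
    (MeasurableSet.biUnion A.to_countable fun i _ => measurableSet_lt (hg i) measurable_const)

lemma iSup_sub_iInf_le_of_notMem_gapSet {g : ι → Ω → ℝ} (hg : ∀ i ω, g i ω ∈ Set.Icc (0 : ℝ) 1)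
    {γ : ℝ} (hγ : 0 < γ) {A : Set ι} {ω : Ω}
    (hω : ω ∉ ⋃ j ∈ Finset.range (⌈1 / γ⌉₊ + 1), gapSet g (j * γ) γ A) :
    (⨆ i : A, g i ω) - ⨅ i : A, g i ω ≤ 3 * γ := by
  by_contra! hlt
  rcases isEmpty_or_nonempty A with hA | hA
  · simp at hlt
    linarith
  set u := ⨆ i : A, g i ω
  set l := ⨅ i : A, g i ω
  have hl : 0 ≤ l := Real.iInf_nonneg fun i => (hg i ω).1
  have hu : u ≤ 1 := ciSup_le fun i => (hg i ω).2
  set j : ℕ := ⌊(l + γ) / γ⌋₊ + 1 with hj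
  have h1 : l + γ < j * γ := by
    have := Nat.lt_floor_add_one ((l + γ) / γ)
    rw [div_lt_iff₀ hγ] at this
    simpa [hj] using this
  have h2 : j * γ ≤ l + 2 * γ := by
    have := Nat.floor_le (a := (l + γ) / γ) (by positivity)
    rw [le_div_iff₀ hγ] at this
    rw [hj]
    push_cast
    linarith
  have h3 : j < ⌈1 / γ⌉₊ + 1 := by
    have h4 : (j : ℝ) < 1 / γ := by
      rw [lt_div_iff₀ hγ]
      linarith
    exact_mod_cast (h4.trans_le (Nat.le_ceil _)).trans (lt_add_one _)
  obtain ⟨i, hi⟩ := exists_lt_of_lt_ciSup (show j * γ + γ < u by linarith)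
  obtain ⟨i', hi'⟩ := exists_lt_of_ciInf_lt (show l < j * γ - γ by linarith)
  refine hω (Set.mem_biUnion (Finset.mem_coe.2 (Finset.mem_range.2 h3)) ⟨?_, ?_⟩)
  · exact Set.mem_biUnion i.2 hi
  · exact Set.mem_biUnion i'.2 hi'

variable [MeasurableSpace Ω] {μ : Measure Ω}

/-- If the gap sets of `A` on a grid of mesh `γ` are small, then the subfamily indexed by `A` is
contained in a narrow bracket, and so its averages are uniformly close to its integrals. -/
lemma Ergodic.ae_eventually_forall_abs_average_sub_le [IsProbabilityMeasure μ] [Countable ι]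
    {T : Ω → Ω} (hT : Ergodic T μ) {g : ι → Ω → ℝ} (hgm : ∀ i, Measurable (g i))
    (hg : ∀ i ω, g i ω ∈ Set.Icc (0 : ℝ) 1) {γ : ℝ} (hγ : 0 < γ) {A : Set ι}
    (hA : μ.real (⋃ j ∈ Finset.range (⌈1 / γ⌉₊ + 1), gapSet g (j * γ) γ A) ≤ γ) :
    ∀ᵐ ω ∂μ, ∀ᶠ m : ℕ in atTop, ∀ i ∈ A,
      |(1 / (m : ℝ)) * ∑ n ∈ Finset.Icc 1 m, g i (T^[n] ω) - ∫ ω, g i ω ∂μ| ≤ 10 * γ := by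
  set N := ⋃ j ∈ Finset.range (⌈1 / γ⌉₊ + 1), gapSet g (j * γ) γ A with hN
  have hNm : MeasurableSet N :=
    Finset.measurableSet_biUnion _ fun j _ => measurableSet_gapSet hgm _ _ _
  set u : Ω → ℝ := fun ω => ⨆ i : A, g i ω with hu
  set l : Ω → ℝ := fun ω => ⨅ i : A, g i ω with hl
  have hum : Measurable u := Measurable.iSup fun i => hgm i
  have hlm : Measurable l := Measurable.iInf fun i => hgm i
  have hu0 : ∀ ω, 0 ≤ u ω := fun ω => Real.iSup_nonneg fun i => (hg i ω).1
  have hu1 : ∀ ω, u ω ≤ 1 := fun ω => Real.iSup_le (fun i => (hg i ω).2) zero_le_one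
  have hl0 : ∀ ω, 0 ≤ l ω := fun ω => Real.iInf_nonneg fun i => (hg i ω).1
  have hgu : ∀ i ∈ A, ∀ ω, g i ω ≤ u ω := fun i hi ω =>
    le_ciSup (f := fun i : A => g i ω) ⟨1, by rintro _ ⟨i, rfl⟩; exact (hg i ω).2⟩ ⟨i, hi⟩
  have hlg : ∀ i ∈ A, ∀ ω, l ω ≤ g i ω := fun i hi ω =>
    ciInf_le (f := fun i : A => g i ω) ⟨0, by rintro _ ⟨i, rfl⟩; exact (hg i ω).1⟩ ⟨i, hi⟩
  have hl1 : ∀ ω, l ω ≤ 1 := by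
    intro ω
    rcases isEmpty_or_nonempty A with h | ⟨⟨i, hi⟩⟩
    · simp [hl]
    · exact (hlg i hi ω).trans (hg i ω).2
  have bdd : ∀ {f : Ω → ℝ}, Measurable f → (∀ ω, 0 ≤ f ω) → (∀ ω, f ω ≤ 1) → Integrable f μ :=
    fun hf h0 h1 => Integrable.of_bound hf.aestronglyMeasurable 1
      (Eventually.of_forall fun ω => by rw [Real.norm_eq_abs, abs_of_nonneg (h0 ω)]; exact h1 ω)
  have hui := bdd hum hu0 hu1
  have hli := bdd hlm hl0 hl1
  have hgi : ∀ i, Integrable (g i) μ := fun i =>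
    bdd (hgm i) (fun ω => (hg i ω).1) fun ω => (hg i ω).2
  have hwidth : ∫ ω, u ω ∂μ - ∫ ω, l ω ∂μ ≤ 4 * γ := by
    have hNi : Integrable (N.indicator fun _ => (1 : ℝ)) μ := (integrable_const _).indicator hNm
    calc ∫ ω, u ω ∂μ - ∫ ω, l ω ∂μ = ∫ ω, (u ω - l ω) ∂μ := (integral_sub hui hli).symm
      _ ≤ ∫ ω, (3 * γ + N.indicator (fun _ => (1 : ℝ)) ω) ∂μ := by
        refine integral_mono (hui.sub hli) ((integrable_const _).add hNi) fun ω => ?_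
        by_cases hω : ω ∈ N
        · simp only [Set.indicator_of_mem hω]
          linarith [hu1 ω, hl0 ω]
        · simp only [Set.indicator_of_notMem hω, add_zero]
          exact iSup_sub_iInf_le_of_notMem_gapSet hg hγ hω
      _ = 3 * γ + μ.real N := by
        rw [integral_add (integrable_const _) hNi, integral_indicator hNm]
        simp
      _ ≤ 4 * γ := by linarith
  filter_upwards [hT.ae_eventually_average_le hum hui hγ,
    hT.ae_eventually_average_le hlm.neg hli.neg hγ] with ω h1 h2
  filter_upwards [h1, h2] with m h1 h2 i hi
  have hm : (0 : ℝ) ≤ 1 / m := by positivity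
  have a1 : (1 / (m : ℝ)) * ∑ n ∈ Finset.Icc 1 m, g i (T^[n] ω)
      ≤ (1 / (m : ℝ)) * ∑ n ∈ Finset.Icc 1 m, u (T^[n] ω) :=
    mul_le_mul_of_nonneg_left (Finset.sum_le_sum fun n _ => hgu i hi _) hm
  have a2 : (1 / (m : ℝ)) * ∑ n ∈ Finset.Icc 1 m, l (T^[n] ω)
      ≤ (1 / (m : ℝ)) * ∑ n ∈ Finset.Icc 1 m, g i (T^[n] ω) :=
    mul_le_mul_of_nonneg_left (Finset.sum_le_sum fun n _ => hlg i hi _) hm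
  have b1 : ∫ ω, g i ω ∂μ ≤ ∫ ω, u ω ∂μ := integral_mono (hgi i) hui (hgu i hi)
  have b2 : ∫ ω, l ω ∂μ ≤ ∫ ω, g i ω ∂μ := integral_mono hli (hgi i) (hlg i hi)
  simp only [Pi.neg_apply, Finset.sum_neg_distrib, mul_neg, integral_neg] at h2
  rw [abs_le]
  constructor <;> linarith

/-- If the gap sets of the members of a filter have measure bounded away from zero, then they
have, up to null sets, a common part of positive measure. -/
lemma exists_forall_measure_diff_gapSet_eq_zero [IsFiniteMeasure μ] [Countable ι]
    {g : ι → Ω → ℝ} (hgm : ∀ i, Measurable (g i)) {α γ : ℝ} {U : Filter ι} {δ : ℝ} (hδ : 0 < δ)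
    (hU : ∀ A ∈ U, δ ≤ μ.real (gapSet g α γ A)) :
    ∃ E : Set Ω, 0 < μ E ∧ ∀ A ∈ U, μ (E \ gapSet g α γ A) = 0 := by
  set V : Set ℝ := (fun A => μ.real (gapSet g α γ A)) '' U.sets with hV
  have hVne : V.Nonempty := ⟨_, Set.univ, univ_mem, rfl⟩
  have hVb : BddBelow V := ⟨δ, by rintro _ ⟨A, hA, rfl⟩; exact hU A hA⟩
  have hinf : ∀ A ∈ U, sInf V ≤ μ.real (gapSet g α γ A) := fun A hA => csInf_le hVb ⟨A, hA, rfl⟩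
  have hδV : δ ≤ sInf V := le_csInf hVne (by rintro _ ⟨A, hA, rfl⟩; exact hU A hA)
  have hex : ∀ n : ℕ, ∃ A ∈ U, μ.real (gapSet g α γ A) < sInf V + 1 / ((n : ℝ) + 1) := by
    intro n
    obtain ⟨_, ⟨A, hA, rfl⟩, h⟩ :=
      exists_lt_of_csInf_lt hVne (lt_add_of_pos_right (sInf V) (Nat.one_div_pos_of_nat (n := n)))
    exact ⟨A, hA, h⟩
  choose B hBU hB using hex
  set A : ℕ → Set ι := fun n => ⋂ i ∈ Finset.range (n + 1), B i with hA
  have hAU : ∀ n, A n ∈ U := fun n => (biInter_finset_mem _).2 fun i _ => hBU i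
  have hAB : ∀ n, A n ⊆ B n := fun n => Set.biInter_subset_of_mem (by simp)
  have hAanti : Antitone A := fun m n hmn =>
    Set.biInter_subset_biInter_left fun i hi => by
      simp only [Finset.coe_range, Set.mem_Iio] at hi ⊢; omega
  have hlim : Tendsto (fun n => μ.real (gapSet g α γ (A n))) atTop
      (𝓝 (μ.real (⋂ n, gapSet g α γ (A n)))) := by
    refine (ENNReal.continuousAt_toReal (measure_ne_top _ _)).tendsto.comp
      (tendsto_measure_iInter_atTop
        (fun n => (measurableSet_gapSet hgm α γ _).nullMeasurableSet)
        (fun m n hmn => gapSet_mono g α γ (hAanti hmn)) ⟨0, measure_ne_top _ _⟩)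
  refine ⟨⋂ n, gapSet g α γ (A n), ?_, fun C hC => ?_⟩
  · have : 0 < μ.real (⋂ n, gapSet g α γ (A n)) :=
      hδ.trans_le (ge_of_tendsto' hlim fun n => hU _ (hAU n))
    exact (ENNReal.toReal_pos_iff.1 this).1
  · rw [← measureReal_eq_zero_iff]
    refine le_antisymm (ge_of_tendsto' tendsto_one_div_add_atTop_nhds_zero_nat fun n => ?_)
      measureReal_nonneg
    have hsub : (⋂ n, gapSet g α γ (A n)) \ gapSet g α γ C
        ⊆ gapSet g α γ (B n) \ gapSet g α γ (B n ∩ C) := fun ω hω =>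
      ⟨gapSet_mono g α γ (hAB n) (Set.mem_iInter.1 hω.1 n),
        fun h => hω.2 (gapSet_mono g α γ Set.inter_subset_right h)⟩
    refine (measureReal_mono hsub).trans ?_
    rw [measureReal_sdiff (gapSet_mono g α γ Set.inter_subset_left)
      (measurableSet_gapSet hgm α γ _)]
    linarith [hB n, hinf _ (inter_mem (hBU n) hC)]

/-- The side of the gap around `α` selected by a Boolean. -/
def gapSide (f : Ω → ℝ) (α γ : ℝ) : Bool → Set Ω
  | true => {ω | α + γ < f ω}
  | false => {ω | f ω < α - γ}

lemma eventually_measure_inter_gapSide_pos [Countable ι] {g : ι → Ω → ℝ} {α γ : ℝ}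
    {U : Ultrafilter ι} {E C : Set Ω} (hE : ∀ A ∈ U, μ (E \ gapSet g α γ A) = 0) (hCE : C ⊆ E)
    (hC : 0 < μ C) (b : Bool) : ∀ᶠ i in (U : Filter ι), 0 < μ (C ∩ gapSide (g i) α γ b) := by
  by_contra hcon
  replace hcon := Ultrafilter.eventually_not.2 hcon
  set B : Set ι := {i | ¬ 0 < μ (C ∩ gapSide (g i) α γ b)}
  have hnull : μ (⋃ i ∈ B, C ∩ gapSide (g i) α γ b) = 0 :=
    (measure_biUnion_null_iff B.to_countable).2 fun i hi => nonpos_iff_eq_zero.1 (not_lt.1 hi)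
  refine hC.ne' (measure_mono_null (t := (E \ gapSet g α γ B) ∪
    ⋃ i ∈ B, C ∩ gapSide (g i) α γ b) ?_ (measure_union_null (hE B hcon) hnull))
  intro ω hω
  by_cases h : ω ∈ gapSet g α γ B
  · right
    cases b with
    | true =>
      obtain ⟨i, hi, hi'⟩ := Set.mem_iUnion₂.1 h.1
      exact Set.mem_biUnion hi ⟨hω, hi'⟩
    | false =>
      obtain ⟨i, hi, hi'⟩ := Set.mem_iUnion₂.1 h.2
      exact Set.mem_biUnion hi ⟨hω, hi'⟩
  · exact Or.inl ⟨hCE hω, h⟩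

/-- A set of positive measure contained modulo null sets in all gap sets of an ultrafilter carries
arbitrarily long Boolean independent sequences. -/
lemma exists_fin_independent [Countable ι] {g : ι → Ω → ℝ} {α γ : ℝ} {U : Ultrafilter ι}
    {E : Set Ω} (hE0 : 0 < μ E) (hE : ∀ A ∈ U, μ (E \ gapSet g α γ A) = 0) (n : ℕ) :
    ∃ φ : Fin n → ι, ∀ S : Fin n → Bool, 0 < μ (E ∩ ⋂ j, gapSide (g (φ j)) α γ (S j)) := by
  induction n with
  | zero => exact ⟨Fin.elim0, fun S => by simpa using hE0⟩
  | succ n ih =>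
    obtain ⟨φ, hφ⟩ := ih
    have hev : ∀ᶠ i in (U : Filter ι), ∀ (S : Fin n → Bool) (b : Bool),
        0 < μ ((E ∩ ⋂ j, gapSide (g (φ j)) α γ (S j)) ∩ gapSide (g i) α γ b) :=
      eventually_all.2 fun S => eventually_all.2 fun b =>
        eventually_measure_inter_gapSide_pos hE Set.inter_subset_left (hφ S) b
    obtain ⟨i, hi⟩ := hev.exists
    refine ⟨Fin.snoc φ i, fun S => (hi (Fin.init S) (S (Fin.last n))).trans_le
      (measure_mono fun ω hω => ⟨hω.1.1, Set.mem_iInter.2 fun j => ?_⟩)⟩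
    induction j using Fin.lastCases with
    | last => simpa using hω.2
    | cast j => simpa [Fin.init] using Set.mem_iInter.1 hω.1.2 j

end Bracketing

/-- A Boolean independent family of `2 ^ k` functions shatters some set of `k` points. -/
lemma exists_gammaShatters_of_independent {X : Type*} {F : Set (X → ℝ)} {α γ : ℝ} (hγ : 0 < γ)
    (k : ℕ) (φ : Finset (Fin k) → F)
    (hφ : ∀ S : Finset (Fin k) → Bool, ∃ x, ∀ s, x ∈ gapSide (φ s : X → ℝ) α γ (S s)) :
    ∃ D : Finset X, D.card = k ∧ GammaShatters F γ D := by
  classical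
  choose p hp using fun j : Fin k => hφ fun s => decide (j ∈ s)
  have hin : ∀ j s, j ∈ s → α + γ < (φ s : X → ℝ) (p j) := fun j s hj => by
    simpa [gapSide, hj] using hp j s
  have hout : ∀ j s, j ∉ s → (φ s : X → ℝ) (p j) < α - γ := fun j s hj => by
    simpa [gapSide, hj] using hp j s
  have hinj : Function.Injective p := by
    intro j j' hjj
    by_contra hne
    have h1 := hin j {j} (by simp)
    have h2 := hout j' {j} (by simpa using Ne.symm hne)
    rw [hjj] at h1
    linarith
  refine ⟨Finset.univ.image p, by simp [Finset.card_image_of_injective _ hinj], α, fun D₀ hD₀ =>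
    ⟨φ (Finset.univ.filter fun j => p j ∈ D₀), Subtype.coe_prop _, fun x hx => ?_,
      fun x hx hx0 => ?_⟩⟩
  · obtain ⟨j, -, rfl⟩ := Finset.mem_image.1 (hD₀ hx)
    exact hin j _ (by simpa using hx)
  · obtain ⟨j, -, rfl⟩ := Finset.mem_image.1 hx
    exact hout j _ (by simpa using hx0)

theorem limsup_discrepancy_le_of_finite_gap_dimension
    {X Ω : Type*} [MetricSpace X] [CompleteSpace X]
    [TopologicalSpace.SeparableSpace X] [MeasurableSpace X] [BorelSpace X]
    (F : Set (X → ℝ)) (hFc : F.Countable)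
    (hFm : ∀ f ∈ F, Measurable f)
    (hFb : ∀ f ∈ F, ∀ x, f x ∈ Set.Icc (0 : ℝ) 1)
    (γ : ℝ) (hγ : 0 < γ) (k : ℕ)
    (hdim : ∀ D : Finset X, D.card = k → ¬ GammaShatters F γ D)
    [MeasurableSpace Ω] (μ : Measure Ω) [IsProbabilityMeasure μ]
    (T : Ω → Ω) (ξ : Ω → X) (hT : Ergodic T μ) (hξ : Measurable ξ) :
    ∀ᵐ ω ∂μ, Filter.limsup (fun m : ℕ => discrepancy μ T ξ F m ω) Filter.atTop ≤ 10 * γ := by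
  have : Countable F := hFc
  set g : F → Ω → ℝ := fun f ω => (f : X → ℝ) (ξ ω)
  have hgm : ∀ f, Measurable (g f) := fun f => (hFm f f.2).comp hξ
  have hgb : ∀ f ω, g f ω ∈ Set.Icc (0 : ℝ) 1 := fun f ω => hFb f f.2 _
  let good : Set F → Prop := fun A => ∀ᵐ ω ∂μ, ∀ᶠ m : ℕ in atTop, ∀ f ∈ A,
    |(1 / (m : ℝ)) * ∑ n ∈ Finset.Icc 1 m, g f (T^[n] ω) - ∫ ω, g f ω ∂μ| ≤ 10 * γ
  have hgood : good Set.univ := by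
    by_contra hbad
    let L : Filter F := Filter.comk good
      (Eventually.of_forall fun ω => Eventually.of_forall fun m f hf => hf.elim)
      (fun t ht s hst => ht.mono fun ω h => h.mono fun m h f hf => h f (hst hf))
      (fun s hs t ht => by
        filter_upwards [hs, ht] with ω h1 h2
        filter_upwards [h1, h2] with m h1 h2 f hf
        exact hf.elim (h1 f) (h2 f))
    have : L.NeBot := by
      refine ⟨fun h => hbad ?_⟩
      have : (∅ : Set F) ∈ L := h ▸ Filter.mem_bot
      change good ∅ᶜ at this
      rwa [Set.compl_empty] at this
    let U := Ultrafilter.of L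
    have hU : ∀ A ∈ U, ¬ good A := by
      intro A hA h
      refine Ultrafilter.compl_mem_iff_notMem.1 (Ultrafilter.of_le L ?_ : Aᶜ ∈ U) hA
      change good Aᶜᶜ
      rwa [compl_compl]
    have hα : ∃ α : ℝ, ∃ δ > 0, ∀ A ∈ (U : Filter F), δ ≤ μ.real (gapSet g α γ A) := by
      by_contra! hsmall
      set K := ⌈1 / γ⌉₊ + 1 with hK
      have hδ : 0 < γ / K := by positivity
      choose A hAU hA using fun j : ℕ => hsmall (j * γ) (γ / K) hδ
      refine hU (⋂ j ∈ Finset.range K, A j) ((biInter_finset_mem _).2 fun j _ => hAU j)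
        (hT.ae_eventually_forall_abs_average_sub_le hgm hgb hγ ?_)
      calc _ ≤ ∑ j ∈ Finset.range K, μ.real (gapSet g (j * γ) γ (⋂ j ∈ Finset.range K, A j)) :=
            measureReal_biUnion_finset_le _ _
        _ ≤ ∑ j ∈ Finset.range K, γ / K := by
            refine Finset.sum_le_sum fun j hj => (measureReal_mono
              (gapSet_mono g _ γ (Set.biInter_subset_of_mem hj))).trans (hA j).le
        _ = γ := by
            rw [Finset.sum_const, Finset.card_range, nsmul_eq_mul]
            exact mul_div_cancel₀ γ (by positivity)
    obtain ⟨α, δ, hδ, hα⟩ := hα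
    obtain ⟨E, hE0, hE⟩ := exists_forall_measure_diff_gapSet_eq_zero hgm hδ hα
    let e := Fintype.equivFin (Finset (Fin k))
    obtain ⟨φ, hφ⟩ := exists_fin_independent hE0 hE (Fintype.card (Finset (Fin k)))
    obtain ⟨D, hD, hsh⟩ := exists_gammaShatters_of_independent (F := F) (α := α) hγ k
      (fun s => φ (e s)) fun S => by
        obtain ⟨ω, -, hω⟩ := nonempty_of_measure_ne_zero (hφ fun j => S (e.symm j)).ne'
        refine ⟨ξ ω, fun s => ?_⟩
        have := Set.mem_iInter.1 hω (e s)
        rw [e.symm_apply_apply] at this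
        cases h : S s <;> rw [h] at this <;> exact this
    exact hdim D hD hsh
  filter_upwards [hgood] with ω hω
  refine Filter.limsup_le_of_le ?_ (hω.mono fun m hm => ?_)
  · exact Filter.isCoboundedUnder_le_of_le atTop (x := 0) fun m =>
      Real.iSup_nonneg fun f => abs_nonneg _
  · exact Real.iSup_le (fun f => hm f (Set.mem_univ f)) (by positivity)
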